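/- arXiv:2105.07915 — 4 statements merged into one kernel-verified Lean document; each statement's English description precedes it below -/
import Mathlib

section
/- Let H > 0, T > 0, r ∈ ℝ, σ > 0, μ > r, x₀ > 0, p ∈ ℝ, and 0 < z < H·e^(−rT). Set ϑ = (μ − r)/σ, α = (μ − r)/σ², k = x₀^α·exp(α(μ + r − σ²)T/2). Let q ∈ ℝ satisfy Φ(q) = 1 − z·e^(rT)/H, let a_p := H^(p−1)·exp(ϑ√T·q − ½ϑ²T), and define the strike K* := x₀·exp((r − σ²/2)T + σ√T·q). Then for every x > 0: k·x^(−α) ≤ H^(p−1)/a_p if and only if x ≥ K*. In particular the set {x : k·x^(−α) ≤ H^(p−1)/a_p}, and hence the optimal modified claim, does not depend on p, so the optimal policies of quantile hedging (p = 0) and efficient hedging (p = 1) of a constant claim coincide. -/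
/-- The standard normal cumulative distribution function. -/
noncomputable def Phi (x : ℝ) : ℝ :=
  ∫ t in Set.Iic x, Real.exp (-t ^ 2 / 2) / Real.sqrt (2 * Real.pi)

/-- The set `{x : k·x^(−α) ≤ H^(p−1)/a_p}` equals `{x : x ≥ K*}` and hence does not
depend on `p`: the optimal policies of quantile hedging and efficient hedging of a
constant claim coincide. -/
theorem stmt_2 (H T r σ μ x₀ p z q : ℝ) (hH : 0 < H) (hT : 0 < T)
    (hσ : 0 < σ) (hμ : r < μ) (hx : 0 < x₀)
    (hz0 : 0 < z) (hz1 : z < H * Real.exp (-(r * T)))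
    (hq : Phi q = 1 - z * Real.exp (r * T) / H) :
    ∀ x : ℝ, 0 < x →
      ((x₀ ^ ((μ - r) / σ ^ 2) *
            Real.exp (((μ - r) / σ ^ 2) * (μ + r - σ ^ 2) * T / 2)) *
          x ^ (-((μ - r) / σ ^ 2))
        ≤ H ^ (p - 1) /
            (H ^ (p - 1) *
              Real.exp (((μ - r) / σ) * Real.sqrt T * q -
                (1/2) * ((μ - r) / σ) ^ 2 * T))
        ↔ x ≥ x₀ * Real.exp ((r - σ ^ 2 / 2) * T + σ * Real.sqrt T * q)) := by
  intro x hx'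
  have hα : 0 < (μ - r) / σ ^ 2 := div_pos (sub_pos.mpr hμ) (by positivity)
  have hθ : (μ - r) / σ = (μ - r) / σ ^ 2 * σ := by field_simp
  have hμα : μ - r = (μ - r) / σ ^ 2 * σ ^ 2 := by field_simp
  have hHp : H ^ (p - 1) ≠ 0 := (Real.rpow_pos_of_pos hH _).ne'
  rw [← div_div, div_self hHp, one_div, ← Real.exp_neg, hθ]
  generalize (μ - r) / σ ^ 2 = α at hα hμα ⊢
  rw [Real.rpow_def_of_pos hx, Real.rpow_def_of_pos hx', ← Real.exp_add, ← Real.exp_add,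
    Real.exp_le_exp, ge_iff_le, ← Real.log_le_log_iff (by positivity) hx',
    Real.log_mul hx.ne' (Real.exp_ne_zero _), Real.log_exp]
  refine Iff.trans ?_ (mul_le_mul_iff_right₀ hα)
  have hμ' : μ = r + α * σ ^ 2 := by linarith
  subst hμ'
  constructor <;> intro h <;> linarith
end

section
/- Let X₀ > 0, σ > 0, T > 0, μ, r ∈ ℝ, and q ∈ ℝ. Set ϑ = (μ − r)/σ and K* := X₀·exp((r − σ²/2)T − σ√T·q). Let ν be the Gaussian measure on ℝ with mean 0 and variance T. Then ν{ w ∈ ℝ : X₀·exp((μ − σ²/2)T + σw) ≥ K* } = Φ( ϑ√T + q ). In particular, if Φ(q) = c₀/(e^(−rT)·c_T), this is the maximized real-world probability Φ(ϑ√T + Φ^{−1}(c₀/(e^(−rT)c_T))) of reaching the goal c_T with initial capital c₀ by replicating digital calls with strike K*. -/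
open MeasureTheory ProbabilityTheory

theorem gaussianReal_zero_one_Iic_toReal (x : ℝ) :
    (gaussianReal 0 1 (Set.Iic x)).toReal = Phi x := by
  rw [gaussianReal_apply_eq_integral 0 one_ne_zero, ENNReal.toReal_ofReal
    (integral_nonneg fun t => gaussianPDFReal_nonneg 0 1 t), Phi]
  congr with t
  simp [gaussianPDFReal, div_eq_inv_mul]

theorem gaussianReal_zero_eq_map_neg_sqrt_mul {T : ℝ} (hT : 0 ≤ T) :
    gaussianReal 0 ⟨T, hT⟩ = (gaussianReal 0 1).map (fun z => -Real.sqrt T * z) := by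
  rw [gaussianReal_map_const_mul, mul_zero, mul_one]
  congr 1
  ext
  simp [Real.sq_sqrt hT]
  rfl

/-- The real-world probability of the terminal stock price exceeding the strike
`K* = X₀·exp((r − σ²/2)T − σ√T·q)` equals `Φ(ϑ√T + q)`, the maximized probability
of reaching the goal. -/
theorem stmt_5 (X₀ σ T μ r q : ℝ) (hX : 0 < X₀) (hσ : 0 < σ) (hT : 0 < T) :
    ((gaussianReal 0 ⟨T, hT.le⟩)
        {w : ℝ | X₀ * Real.exp ((μ - σ ^ 2 / 2) * T + σ * w) ≥
          X₀ * Real.exp ((r - σ ^ 2 / 2) * T - σ * Real.sqrt T * q)}).toReal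
      = Phi (((μ - r) / σ) * Real.sqrt T + q) := by
  rw [gaussianReal_zero_eq_map_neg_sqrt_mul hT.le, Measure.map_apply (by fun_prop)
    (measurableSet_le (by fun_prop) (by fun_prop)), ← gaussianReal_zero_one_Iic_toReal]
  congr 2
  ext z
  have hs : 0 < Real.sqrt T := Real.sqrt_pos.2 hT
  have key : (μ - σ ^ 2 / 2) * T + σ * (-Real.sqrt T * z)
      - ((r - σ ^ 2 / 2) * T - σ * Real.sqrt T * q)
      = σ * Real.sqrt T * ((μ - r) / σ * Real.sqrt T + q - z) := by
    field_simp
    linear_combination (-2 * (μ - r)) * Real.sq_sqrt hT.le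
  simp only [Set.mem_preimage, Set.mem_ofPred_eq, Set.mem_Iic,
    mul_le_mul_iff_right₀ hX, Real.exp_le_exp]
  rw [← sub_nonneg, key, mul_nonneg_iff_of_pos_left (mul_pos hσ hs), sub_nonneg]
end

section
/- Let x > 0, L > 0, σ > 0, τ > 0, r ∈ ℝ, and α > 0. Define f(u) := (1 − (L/u)^α)·𝟙{u ≥ L} for u > 0, and d := (log(x/L) + (r − σ²/2)τ)/(σ√τ). Then ∫_ℝ f( x·exp(σ√τ·y + (r − σ²/2)τ) ) · e^(−y²/2)/√(2π) dy = Φ(d) − (L/x)^α · exp( α²σ²τ/2 + α(σ²/2 − r)τ ) · Φ(d − ασ√τ). (This is the closed-form Black–Scholes value of the optimal modified claim for a risk-averse investor minimizing the lower partial moment of order p > 1, with α = α_p = (μ−r)/(σ²(p−1)); when r = 0 the exponent agrees with the form α(α+1)(σ²/2 − r)τ displayed in the paper.) -/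
/-- The standard normal density is integrable. -/
theorem integrable_stdNormalDensity :
    MeasureTheory.Integrable
      (fun t : ℝ => Real.exp (-t ^ 2 / 2) / Real.sqrt (2 * Real.pi)) := by
  have h := (integrable_exp_neg_mul_sq (b := 1 / 2) (by norm_num)).div_const
    (Real.sqrt (2 * Real.pi))
  refine h.congr (Filter.Eventually.of_forall fun t => ?_)
  simp only
  ring_nf

/-- The normal distribution function as an upper-tail integral of a shifted density. -/
theorem Phi_sub_eq_integral_Ici (d c : ℝ) :
    Phi (d - c) =
      ∫ y in Set.Ici (-d), Real.exp (-(y + c) ^ 2 / 2) / Real.sqrt (2 * Real.pi) := by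
  unfold Phi
  rw [← MeasureTheory.integral_indicator measurableSet_Iic,
    ← MeasureTheory.integral_indicator measurableSet_Ici,
    ← MeasureTheory.integral_sub_left_eq_self _ MeasureTheory.volume (-c)]
  refine MeasureTheory.integral_congr_ae (Filter.Eventually.of_forall fun y => ?_)
  have h : -c - y ≤ d - c ↔ -d ≤ y := by constructor <;> intro h <;> linarith
  simp only [Set.indicator_apply, Set.mem_Iic, Set.mem_Ici, h]
  have h2 : (-c - y) ^ 2 = (y + c) ^ 2 := by ring
  rw [h2]

/-- The lognormal price exceeds the threshold exactly above a standardized log-moneyness. -/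
theorem le_mul_exp_iff {x L s m y : ℝ} (hx : 0 < x) (hL : 0 < L) (hs : 0 < s) :
    L ≤ x * Real.exp (s * y + m) ↔ -((Real.log (x / L) + m) / s) ≤ y := by
  rw [← Real.log_le_log_iff hL (by positivity), Real.log_mul hx.ne' (Real.exp_ne_zero _),
    Real.log_exp, Real.log_div hx.ne' hL.ne', ← neg_div, div_le_iff₀ hs]
  constructor <;> intro h <;> linarith

/-- Completing the square in the power of a lognormal price against the normal density. -/
theorem div_mul_exp_rpow_mul_exp {x L : ℝ} (s m y α : ℝ) (hx : 0 < x) (hL : 0 < L) :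
    (L / (x * Real.exp (s * y + m))) ^ α * Real.exp (-y ^ 2 / 2) =
      (L / x) ^ α * Real.exp (α ^ 2 * s ^ 2 / 2 - α * m) *
        Real.exp (-(y + α * s) ^ 2 / 2) := by
  rw [← div_div, Real.div_rpow (by positivity) (by positivity), ← Real.exp_mul, div_eq_mul_inv,
    ← Real.exp_neg, mul_assoc, mul_assoc, ← Real.exp_add, ← Real.exp_add]
  ring_nf

/-- Closed-form Black–Scholes value of the optimal modified claim
`f(u) = (1 − (L/u)^α)·𝟙{u ≥ L}` for a risk-averse investor minimizing the lower
partial moment of order `p > 1`. -/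
theorem stmt_10 (x L σ τ r α : ℝ) (hx : 0 < x) (hL : 0 < L) (hσ : 0 < σ)
    (hτ : 0 < τ) (hα : 0 < α) :
    ∫ y : ℝ,
        (1 - (L / (x * Real.exp (σ * Real.sqrt τ * y + (r - σ ^ 2 / 2) * τ))) ^ α) *
          (if L ≤ x * Real.exp (σ * Real.sqrt τ * y + (r - σ ^ 2 / 2) * τ)
            then 1 else 0) *
          (Real.exp (-y ^ 2 / 2) / Real.sqrt (2 * Real.pi))
      = Phi ((Real.log (x / L) + (r - σ ^ 2 / 2) * τ) / (σ * Real.sqrt τ)) -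
          (L / x) ^ α * Real.exp (α ^ 2 * σ ^ 2 * τ / 2 + α * (σ ^ 2 / 2 - r) * τ) *
            Phi ((Real.log (x / L) + (r - σ ^ 2 / 2) * τ) / (σ * Real.sqrt τ) -
              α * σ * Real.sqrt τ) := by
  set s := σ * Real.sqrt τ with hs_def
  set m := (r - σ ^ 2 / 2) * τ with hm_def
  set d := (Real.log (x / L) + m) / s with hd_def
  have hs : 0 < s := by positivity
  have hs2 : s ^ 2 = σ ^ 2 * τ := by rw [hs_def, mul_pow, Real.sq_sqrt hτ.le]
  have hexp : α ^ 2 * σ ^ 2 * τ / 2 + α * (σ ^ 2 / 2 - r) * τ = α ^ 2 * s ^ 2 / 2 - α * m := by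
    rw [hs2, hm_def]; ring
  have hPhi : Phi d =
      ∫ y in Set.Ici (-d), Real.exp (-y ^ 2 / 2) / Real.sqrt (2 * Real.pi) := by
    simpa using Phi_sub_eq_integral_Ici d 0
  rw [hexp, mul_assoc α σ, ← hs_def, hPhi, Phi_sub_eq_integral_Ici,
    ← MeasureTheory.integral_const_mul,
    ← MeasureTheory.integral_sub integrable_stdNormalDensity.integrableOn
      ((integrable_stdNormalDensity.comp_add_right (α * s)).const_mul _).integrableOn,
    ← MeasureTheory.integral_indicator measurableSet_Ici]
  refine MeasureTheory.integral_congr_ae (Filter.Eventually.of_forall fun y => ?_)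
  simp only [Set.indicator_apply, Set.mem_Ici, le_mul_exp_iff hx hL hs, ← hd_def]
  split_ifs
  · rw [mul_one, sub_mul, one_mul, ← mul_div_assoc, div_mul_exp_rpow_mul_exp s m y α hx hL,
      mul_div_assoc]
  · simp
end

section
/- Let x > 0, K > 0 with x ≠ K, σ > 0, and r ∈ ℝ. Then, as s → 0+, Φ( (log(x/K) + (r − σ²/2)s)/(σ√s) ) converges to 1 if x > K and to 0 if x < K. That is, the (undiscounted) Black–Scholes value of the digital European call converges to the digital payoff 𝟙{x ≥ K} at maturity for every terminal stock price not equal to the strike. -/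
theorem Phi_eq_cdf_gaussianReal : Phi = ProbabilityTheory.cdf (ProbabilityTheory.gaussianReal 0 1) := by
  funext x
  rw [ProbabilityTheory.cdf_eq_real, MeasureTheory.measureReal_def,
    ProbabilityTheory.gaussianReal_apply_eq_integral 0 one_ne_zero, ENNReal.toReal_ofReal
      (MeasureTheory.integral_nonneg (ProbabilityTheory.gaussianPDFReal_nonneg 0 1)), Phi]
  congr 1
  funext t
  simp [ProbabilityTheory.gaussianPDFReal, div_eq_inv_mul]

theorem tendsto_inv_mul_sqrt_nhdsGT_zero {σ : ℝ} (hσ : 0 < σ) :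
    Filter.Tendsto (fun s : ℝ => (σ * Real.sqrt s)⁻¹)
      (nhdsWithin 0 (Set.Ioi 0)) Filter.atTop := by
  refine Filter.Tendsto.inv_tendsto_nhdsGT_zero (tendsto_nhdsWithin_iff.2 ⟨?_, ?_⟩)
  · have h : Continuous fun s : ℝ => σ * Real.sqrt s := by fun_prop
    simpa using (h.tendsto 0).mono_left nhdsWithin_le_nhds
  · filter_upwards [self_mem_nhdsWithin] with s hs
    exact mul_pos hσ (Real.sqrt_pos.2 hs)

theorem tendsto_add_mul_nhdsGT_zero (a b : ℝ) :
    Filter.Tendsto (fun s : ℝ => a + b * s) (nhdsWithin 0 (Set.Ioi 0)) (nhds a) := by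
  have h : Continuous fun s : ℝ => a + b * s := by fun_prop
  simpa using (h.tendsto 0).mono_left nhdsWithin_le_nhds

/-- As time to maturity `s → 0+`, the undiscounted Black–Scholes digital call value
`Φ(d₋)` converges to the digital payoff: to `1` if `x > K` and to `0` if `x < K`. -/
theorem stmt_16 (x K σ r : ℝ) (hx : 0 < x) (hK : 0 < K) (hne : x ≠ K) (hσ : 0 < σ) :
    (K < x →
      Filter.Tendsto
        (fun s : ℝ =>
          Phi ((Real.log (x / K) + (r - σ ^ 2 / 2) * s) / (σ * Real.sqrt s)))
        (nhdsWithin 0 (Set.Ioi 0)) (nhds 1)) ∧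
    (x < K →
      Filter.Tendsto
        (fun s : ℝ =>
          Phi ((Real.log (x / K) + (r - σ ^ 2 / 2) * s) / (σ * Real.sqrt s)))
        (nhdsWithin 0 (Set.Ioi 0)) (nhds 0)) := by
  simp only [div_eq_mul_inv _ (σ * _)]
  rw [Phi_eq_cdf_gaussianReal]
  have hnum := tendsto_add_mul_nhdsGT_zero (Real.log (x / K)) (r - σ ^ 2 / 2)
  have hden := tendsto_inv_mul_sqrt_nhdsGT_zero hσ
  refine ⟨fun h => ?_, fun h => ?_⟩
  · exact (ProbabilityTheory.tendsto_cdf_atTop _).comp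
      (hnum.pos_mul_atTop (Real.log_pos ((one_lt_div hK).2 h)) hden)
  · exact (ProbabilityTheory.tendsto_cdf_atBot _).comp
      (hnum.neg_mul_atTop (Real.log_neg (div_pos hx hK) ((div_lt_one hK).2 h)) hden)
end
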